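/- arXiv:1608.03043 — 9 statements merged into one kernel-verified Lean document; each statement's English description precedes it below -/
import Mathlib

section
/- Let ⟨X,d⟩ and ⟨Y,ρ⟩ be metric spaces, f : X → Y a function, and A a nonempty subset of X. Then the oscillation of f at A satisfies Ω(f,A) = inf_{n ∈ ℕ} sup_{a ∈ A} ω_n(f,a), where the infimum and supremum are taken in the extended nonnegative reals [0,∞]. -/
open Metric Filter ENNReal Topology

/-- The `ε`-enlargement `S_d(A,ε) = ⋃_{a ∈ A} S_d(a,ε)` of a set `A`. -/
def SEnl {X : Type*} [MetricSpace X] (A : Set X) (ε : ℝ) : Set X :=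
  ⋃ a ∈ A, Metric.ball a ε

/-- `Ω_n(f,A) = sup {ρ(f x, f w) : x, w ∈ S_d(A,1/n), d(x,w) < 1/n}` in `[0,∞]`. -/
noncomputable def OmegaN {X Y : Type*} [MetricSpace X] [MetricSpace Y]
    (f : X → Y) (A : Set X) (n : ℕ) : ℝ≥0∞ :=
  ⨆ (x ∈ SEnl A (1 / (n : ℝ))) (w ∈ SEnl A (1 / (n : ℝ))) (_ : dist x w < 1 / (n : ℝ)),
    edist (f x) (f w)

/-- The oscillation `Ω(f,A) = inf_{n ≥ 1} Ω_n(f,A)` of `f` at `A`. -/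
noncomputable def Omega {X Y : Type*} [MetricSpace X] [MetricSpace Y]
    (f : X → Y) (A : Set X) : ℝ≥0∞ :=
  ⨅ n : ℕ, OmegaN f A (n + 1)

theorem OmegaN_le_iSup_ediam {X Y : Type*} [MetricSpace X] [MetricSpace Y]
    (f : X → Y) (A : Set X) {n : ℕ} {r : ℝ} (h : 2 * (1 / (n : ℝ)) ≤ r) :
    OmegaN f A n ≤ ⨆ a ∈ A, Metric.ediam (f '' Metric.ball a r) := by
  refine iSup₂_le fun x hx => iSup₂_le fun w _ => iSup_le fun hxw => ?_
  obtain ⟨a, ha, hxa⟩ := Set.mem_iUnion₂.1 hx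
  rw [Metric.mem_ball] at hxa
  have hx' : x ∈ Metric.ball a r := by
    rw [Metric.mem_ball]
    linarith [dist_nonneg (x := x) (y := a)]
  have hw' : w ∈ Metric.ball a r := by
    rw [Metric.mem_ball]
    linarith [dist_triangle_left w a x]
  exact (Metric.edist_le_ediam_of_mem (Set.mem_image_of_mem f hx')
    (Set.mem_image_of_mem f hw')).trans
      (le_iSup₂ (f := fun a _ => Metric.ediam (f '' Metric.ball a r)) a ha)

theorem iSup_ediam_le_OmegaN {X Y : Type*} [MetricSpace X] [MetricSpace Y]
    (f : X → Y) (A : Set X) {n : ℕ} {r : ℝ} (h : 2 * r ≤ 1 / (n : ℝ)) :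
    ⨆ a ∈ A, Metric.ediam (f '' Metric.ball a r) ≤ OmegaN f A n := by
  refine iSup₂_le fun a ha => Metric.ediam_le ?_
  rintro _ ⟨x, hx, rfl⟩ _ ⟨w, hw, rfl⟩
  rw [Metric.mem_ball] at hx hw
  have mem_SEnl : ∀ y, dist y a < r → y ∈ SEnl A (1 / (n : ℝ)) := fun y hy =>
    Set.mem_iUnion₂.2 ⟨a, ha, by
      rw [Metric.mem_ball]
      linarith [dist_nonneg (x := y) (y := a)]⟩
  have hxw : dist x w < 1 / (n : ℝ) := by linarith [dist_triangle_right x w a]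
  exact le_iSup₂_of_le x (mem_SEnl x hx) <| le_iSup₂_of_le w (mem_SEnl w hw) <|
    le_iSup_of_le hxw le_rfl

/-- `Ω(f,A) = inf_{n ≥ 1} sup_{a ∈ A} ω_n(f,a)` where
`ω_n(f,a) = diam_ρ f(S_d(a,1/n))`. -/
theorem oscillation_eq_inf_sup_pointwise_oscillation
    {X Y : Type*} [MetricSpace X] [MetricSpace Y]
    (f : X → Y) (A : Set X) (hA : A.Nonempty) :
    Omega f A = ⨅ n : ℕ, ⨆ a ∈ A, EMetric.diam (f '' Metric.ball a (1 / ((n : ℝ) + 1))) := by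
  have two_mul_one_div : ∀ n : ℕ,
      2 * (1 / (((2 * n + 1 : ℕ) : ℝ) + 1)) = 1 / ((n : ℝ) + 1) := fun n => by
    push_cast
    field_simp
    ring
  refine le_antisymm (le_iInf fun n => ?_) (le_iInf fun n => ?_)
  · refine (iInf_le _ (2 * n + 1)).trans (OmegaN_le_iSup_ediam f A ?_)
    rw [Nat.cast_succ, two_mul_one_div]
  · refine (iInf_le _ (2 * n + 1)).trans (iSup_ediam_le_OmegaN f A ?_)
    rw [Nat.cast_succ n, two_mul_one_div]
end

section
/- Let ⟨X,d⟩ and ⟨Y,ρ⟩ be metric spaces and f : X → Y a function. Then f is uniformly continuous on X if and only if the sequence ⟨Ω_n(f,·)⟩ converges uniformly to the zero function on the family of all nonempty subsets of X, i.e., for every ε > 0 there exists N ∈ ℕ such that for all n ≥ N and every nonempty subset A of X, Ω_n(f,A) ≤ ε. -/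
open Metric Filter ENNReal Topology

/-- `f` is uniformly continuous iff `⟨Ω_n(f,·)⟩` converges uniformly to the zero
function on the family of all nonempty subsets of `X`. -/
theorem uniformContinuous_iff_oscillation_tendsto_uniformly
    {X Y : Type*} [MetricSpace X] [MetricSpace Y] (f : X → Y) :
    UniformContinuous f ↔
      ∀ ε : ℝ, 0 < ε → ∃ N : ℕ, 0 < N ∧ ∀ n : ℕ, N ≤ n →
        ∀ A : Set X, A.Nonempty → OmegaN f A n ≤ ENNReal.ofReal ε := by
  constructor
  · intro hf ε hε
    obtain ⟨δ, hδ, h⟩ := Metric.uniformContinuous_iff.1 hf ε hε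
    obtain ⟨N, hN⟩ := exists_nat_one_div_lt hδ
    refine ⟨N + 1, N.succ_pos, fun n hn A _ => ?_⟩
    have hnδ : 1 / (n : ℝ) < δ := by
      refine lt_of_le_of_lt (one_div_le_one_div_of_le (by positivity) ?_) hN
      exact_mod_cast hn
    refine iSup₂_le fun x _ => iSup₂_le fun w _ => iSup_le fun hxw => ?_
    rw [edist_dist]
    exact ENNReal.ofReal_le_ofReal (h (hxw.trans hnδ)).le
  · intro h
    refine Metric.uniformContinuous_iff.2 fun ε hε => ?_
    obtain ⟨N, hN, hΩ⟩ := h (ε / 2) (half_pos hε)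
    have hpos : 0 < 1 / (N : ℝ) := one_div_pos.2 (Nat.cast_pos.2 hN)
    refine ⟨1 / (N : ℝ), hpos, fun {x w} hxw => ?_⟩
    have hmem (z : X) : z ∈ SEnl Set.univ (1 / (N : ℝ)) :=
      Set.mem_biUnion (Set.mem_univ z) (Metric.mem_ball_self hpos)
    have hle : edist (f x) (f w) ≤ OmegaN f Set.univ N :=
      le_iSup₂_of_le x (hmem x) <| le_iSup₂_of_le w (hmem w) <| le_iSup_of_le hxw le_rfl
    have hdist := hle.trans (hΩ N le_rfl Set.univ ⟨x, Set.mem_univ x⟩)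
    rw [edist_dist, ENNReal.ofReal_le_ofReal_iff (half_pos hε).le] at hdist
    exact hdist.trans_lt (half_lt_self hε)
end

section
/- Let ⟨X,d⟩ and ⟨Y,ρ⟩ be metric spaces, f : X → Y an arbitrary function, A a nonempty subset of X, and α a real number with Ω(f,A) < α. Then there exists n ∈ ℕ such that every nonempty subset B of X with B ⊆ S_d(A, 1/(2n)) satisfies Ω(f,B) ≤ Ω_n(f,A) < α. (In particular, A ↦ Ω(f,A) is upper semicontinuous on the nonempty subsets of X equipped with the Vietoris (finite) topology.) -/
open Metric Filter ENNReal Topology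

theorem SEnl_subset_SEnl_of_subset {X : Type*} [MetricSpace X] {A B : Set X} {δ ε η : ℝ}
    (hB : B ⊆ SEnl A δ) (hη : δ + ε ≤ η) : SEnl B ε ⊆ SEnl A η := by
  intro x hx
  simp only [SEnl, Set.mem_iUnion₂, Metric.mem_ball, exists_prop] at hx ⊢
  obtain ⟨b, hb, hxb⟩ := hx
  have hbA := hB hb
  simp only [SEnl, Set.mem_iUnion₂, Metric.mem_ball, exists_prop] at hbA
  obtain ⟨a, ha, hba⟩ := hbA
  exact ⟨a, ha, by linarith [dist_triangle x b a]⟩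

theorem OmegaN_le_OmegaN {X Y : Type*} [MetricSpace X] [MetricSpace Y] (f : X → Y)
    {A B : Set X} {m n : ℕ} (hs : SEnl B (1 / (m : ℝ)) ⊆ SEnl A (1 / (n : ℝ)))
    (hmn : 1 / (m : ℝ) ≤ 1 / (n : ℝ)) : OmegaN f B m ≤ OmegaN f A n :=
  iSup₂_le fun x hx => iSup₂_le fun w hw => iSup_le fun hxw =>
    le_iSup₂_of_le x (hs hx) <| le_iSup₂_of_le w (hs hw) <|
      le_iSup_of_le (hxw.trans_le hmn) le_rfl

theorem Omega_le_OmegaN {X Y : Type*} [MetricSpace X] [MetricSpace Y] (f : X → Y)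
    (A : Set X) {n : ℕ} (hn : 0 < n) : Omega f A ≤ OmegaN f A n := by
  obtain ⟨k, rfl⟩ := Nat.exists_eq_succ_of_ne_zero hn.ne'
  exact iInf_le _ k

/-- If `Ω(f,A) < α` then there is `n ∈ ℕ` with `Ω_n(f,A) < α` such that every nonempty
`B ⊆ S_d(A, 1/(2n))` satisfies `Ω(f,B) ≤ Ω_n(f,A)`; in particular `A ↦ Ω(f,A)` is
upper semicontinuous for the Vietoris (finite) topology. -/
theorem oscillation_upper_semicontinuous_vietoris
    {X Y : Type*} [MetricSpace X] [MetricSpace Y]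
    (f : X → Y) (A : Set X) (hA : A.Nonempty) (α : ℝ)
    (h : Omega f A < ENNReal.ofReal α) :
    ∃ n : ℕ, 0 < n ∧ OmegaN f A n < ENNReal.ofReal α ∧
      ∀ B : Set X, B.Nonempty → B ⊆ SEnl A (1 / (2 * (n : ℝ))) →
        Omega f B ≤ OmegaN f A n := by
  obtain ⟨k, hk⟩ := iInf_lt_iff.mp h
  refine ⟨k + 1, k.succ_pos, hk, fun B _ hB => ?_⟩
  have hpos : (0 : ℝ) < ((k + 1 : ℕ) : ℝ) := by positivity
  have hcast : ((2 * (k + 1) : ℕ) : ℝ) = 2 * ((k + 1 : ℕ) : ℝ) := by push_cast; ring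
  refine (Omega_le_OmegaN f B (n := 2 * (k + 1)) (by positivity)).trans
    (OmegaN_le_OmegaN f ?_ ?_)
  · rw [hcast]
    exact SEnl_subset_SEnl_of_subset hB (le_of_eq (by field_simp; norm_num))
  · rw [hcast]
    exact one_div_le_one_div_of_le hpos (by linarith)
end

section
/- Let ⟨X,d⟩ and ⟨Y,ρ⟩ be metric spaces, f : X → Y a continuous function, A a nonempty subset of X, and α a real number with 0 < α < Ω(f,A). Then there exists a locally finite family 𝒱 of nonempty open subsets of X such that A intersects every member of 𝒱, and every nonempty subset B of X that intersects every member of 𝒱 satisfies Ω(f,B) > α. -/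
open Metric Filter ENNReal Topology

/-- If `Ω(f,A) > β`, then there are points of `A` arbitrarily close to pairs of nearby points whose
`f`-images are more than `β` apart. -/
lemma exists_seq_of_lt_Omega {X Y : Type*} [MetricSpace X] [MetricSpace Y]
    {f : X → Y} {A : Set X} {β : ℝ≥0∞} (h : β < Omega f A) :
    ∃ a x w : ℕ → X, ∀ n, a n ∈ A ∧ dist (x n) (a n) < 1 / ((n : ℝ) + 1) ∧
      dist (x n) (w n) < 1 / ((n : ℝ) + 1) ∧ β < edist (f (x n)) (f (w n)) := by
  have key (n : ℕ) : ∃ a x w : X, a ∈ A ∧ dist x a < 1 / ((n : ℝ) + 1) ∧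
      dist x w < 1 / ((n : ℝ) + 1) ∧ β < edist (f x) (f w) := by
    have hn : β < OmegaN f A (n + 1) := h.trans_le (iInf_le _ n)
    simp only [OmegaN, SEnl, lt_iSup_iff, Set.mem_iUnion, mem_ball, Nat.cast_add,
      Nat.cast_one] at hn
    obtain ⟨x, ⟨a, ha, hxa⟩, w, -, hxw, hβ⟩ := hn
    exact ⟨a, x, w, ha, hxa, hxw, hβ⟩
  choose a x w hyp using key
  exact ⟨a, x, w, hyp⟩

/-- If `B` has points arbitrarily close to pairs of nearby points whose `f`-images are at least `β`
apart, then `Ω(f,B) ≥ β`. -/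
lemma le_Omega {X Y : Type*} [MetricSpace X] [MetricSpace Y]
    {f : X → Y} {B : Set X} {β : ℝ≥0∞}
    (h : ∀ ε > 0, ∃ b ∈ B, ∃ x w : X, dist x b < ε ∧ dist w b < ε ∧ dist x w < ε ∧
      β ≤ edist (f x) (f w)) :
    β ≤ Omega f B := by
  refine le_iInf fun n => ?_
  obtain ⟨b, hb, x, w, hx, hw, hxw, hβ⟩ := h (1 / ((n + 1 : ℕ) : ℝ)) (by positivity)
  refine hβ.trans ?_
  have hxB : x ∈ SEnl B (1 / ((n + 1 : ℕ) : ℝ)) := Set.mem_biUnion hb hx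
  have hwB : w ∈ SEnl B (1 / ((n + 1 : ℕ) : ℝ)) := Set.mem_biUnion hb hw
  exact le_iSup₂_of_le x hxB (le_iSup₂_of_le w hwB (le_iSup_of_le hxw le_rfl))

/-- If `f` is continuous and the `n`-th center is within `1 / (n + 1)` of a pair of nearby points
whose `f`-images are more than `β > 0` apart, then the balls of radius `1 / (n + 1)` about the
centers form a locally finite family. -/
lemma locallyFinite_ball_of_lt_edist {X Y : Type*} [MetricSpace X] [MetricSpace Y]
    {f : X → Y} (hf : Continuous f) {β : ℝ≥0∞} (hβ : β ≠ 0) {a x w : ℕ → X}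
    (hxa : ∀ n, dist (x n) (a n) < 1 / ((n : ℝ) + 1))
    (hxw : ∀ n, dist (x n) (w n) < 1 / ((n : ℝ) + 1))
    (hfxw : ∀ n, β < edist (f (x n)) (f (w n))) :
    LocallyFinite fun n : ℕ => ball (a n) (1 / ((n : ℝ) + 1)) := by
  intro z
  have hnhds : ∀ᶠ y in 𝓝 z, edist (f y) (f z) < β / 2 :=
    hf.continuousAt (Metric.eball_mem_nhds (f z) (ENNReal.half_pos hβ))
  obtain ⟨δ, hδ, hball⟩ := Metric.eventually_nhds_iff.1 hnhds
  obtain ⟨N, hN⟩ := exists_nat_one_div_lt (show 0 < δ / 4 by positivity)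
  refine ⟨ball z (δ / 4), ball_mem_nhds z (by positivity), (Set.finite_lt_nat N).subset ?_⟩
  rintro n ⟨y, hya, hyz⟩
  by_contra hn
  have hnN : N ≤ n := not_lt.1 hn
  have hsmall : 1 / ((n : ℝ) + 1) < δ / 4 := (Nat.one_div_le_one_div hnN).trans_lt hN
  rw [mem_ball] at hya hyz
  have hx : dist (x n) z < δ := by
    linarith [hxa n, dist_triangle4 (x n) (a n) y z, dist_comm (a n) y]
  have hw : dist (w n) z < δ := by
    linarith [hxw n, dist_triangle_left (w n) z (x n), hxa n,
      dist_triangle4 (x n) (a n) y z, dist_comm (a n) y]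
  refine (hfxw n).not_ge ?_
  calc edist (f (x n)) (f (w n)) ≤ edist (f (x n)) (f z) + edist (f (w n)) (f z) :=
        edist_triangle_right _ _ _
    _ ≤ β / 2 + β / 2 := add_le_add (hball hx).le (hball hw).le
    _ = β := ENNReal.add_halves β

/-- If `f` is continuous and `0 < α < Ω(f,A)`, then there is a locally finite family `𝒱`
of nonempty open sets, each met by `A`, such that every nonempty set `B` meeting every
member of `𝒱` has `Ω(f,B) > α`. -/
theorem exists_locallyFinite_family_oscillation_gt
    {X Y : Type*} [MetricSpace X] [MetricSpace Y]
    (f : X → Y) (hf : Continuous f) (A : Set X) (hA : A.Nonempty)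
    (α : ℝ) (hα : 0 < α) (h : ENNReal.ofReal α < Omega f A) :
    ∃ 𝒱 : Set (Set X),
      (∀ V ∈ 𝒱, V.Nonempty ∧ IsOpen V) ∧
      LocallyFinite (fun V : 𝒱 => (V : Set X)) ∧
      (∀ V ∈ 𝒱, (A ∩ V).Nonempty) ∧
      (∀ B : Set X, B.Nonempty → (∀ V ∈ 𝒱, (B ∩ V).Nonempty) →
        ENNReal.ofReal α < Omega f B) := by
  obtain ⟨β, hαβ, hβ⟩ := exists_between h
  obtain ⟨a, x, w, hyp⟩ := exists_seq_of_lt_Omega hβ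
  have hlf := locallyFinite_ball_of_lt_edist hf (bot_le.trans_lt hαβ).ne'
    (fun n => (hyp n).2.1) (fun n => (hyp n).2.2.1) fun n => (hyp n).2.2.2
  have hcenter (n : ℕ) : a n ∈ ball (a n) (1 / ((n : ℝ) + 1)) :=
    mem_ball_self Nat.one_div_pos_of_nat
  refine ⟨Set.range fun n : ℕ => ball (a n) (1 / ((n : ℝ) + 1)), ?_, hlf.on_range, ?_, ?_⟩
  · rintro _ ⟨n, rfl⟩
    exact ⟨⟨a n, hcenter n⟩, isOpen_ball⟩
  · rintro _ ⟨n, rfl⟩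
    exact ⟨a n, (hyp n).1, hcenter n⟩
  · intro B _ hBV
    refine hαβ.trans_le (le_Omega fun ε hε => ?_)
    obtain ⟨n, hn⟩ := exists_nat_one_div_lt (show 0 < ε / 3 by positivity)
    obtain ⟨b, hbB, hba⟩ := hBV _ ⟨n, rfl⟩
    obtain ⟨-, hxa, hxw, hfxw⟩ := hyp n
    rw [mem_ball] at hba
    have hxb := dist_triangle_right (x n) b (a n)
    refine ⟨b, hbB, x n, w n, ?_, ?_, ?_, hfxw.le⟩
    · linarith
    · linarith [dist_triangle_left (w n) b (x n)]
    · linarith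
end

section
/- Let ⟨X,d⟩ and ⟨Y,ρ⟩ be metric spaces, let ⟨f_λ⟩_{λ∈Λ} be a net of functions from X to Y, and let f : X → Y. If for each x ∈ X the net ⟨f_λ⟩ is very strongly uniformly convergent to f on the singleton {x}, then for every nonempty compact subset K of X, ⟨f_λ⟩ is very strongly uniformly convergent to f on K. -/
open Metric Filter ENNReal Topology

/-- A net `⟨f_λ⟩` is very strongly uniformly convergent to `f` on `A` if for each `ε > 0`
there exist `λ₀` and `δ > 0` such that for all `λ ⪰ λ₀` and all `x ∈ S_d(A,δ)`,
`ρ(f_λ(x), f(x)) < ε`. -/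
def VeryStronglyUniformlyConvergentOn {X Y Λ : Type*} [MetricSpace X] [MetricSpace Y]
    [Preorder Λ] (F : Λ → X → Y) (f : X → Y) (A : Set X) : Prop :=
  ∀ ε : ℝ, 0 < ε → ∃ l₀ : Λ, ∃ δ : ℝ, 0 < δ ∧
    ∀ l : Λ, l₀ ≤ l → ∀ x ∈ SEnl A δ, dist (F l x) (f x) < ε

/-- Very strong uniform convergence on every singleton implies very strong uniform
convergence on every nonempty compact subset. -/
theorem veryStronglyUniformlyConvergentOn_of_singletons
    {X Y Λ : Type*} [MetricSpace X] [MetricSpace Y] [Nonempty Λ] [Preorder Λ]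
    (hdir : ∀ a b : Λ, ∃ c : Λ, a ≤ c ∧ b ≤ c)
    (F : Λ → X → Y) (f : X → Y)
    (h : ∀ x : X, VeryStronglyUniformlyConvergentOn F f {x}) :
    ∀ K : Set X, K.Nonempty → IsCompact K →
      VeryStronglyUniformlyConvergentOn F f K := by
  intro K _ hK ε hε
  refine hK.induction_on (p := fun A => ∃ l₀ : Λ, ∃ δ : ℝ, 0 < δ ∧
    ∀ l : Λ, l₀ ≤ l → ∀ x ∈ SEnl A δ, dist (F l x) (f x) < ε) ?_ ?_ ?_ ?_
  · obtain ⟨l₀⟩ := ‹Nonempty Λ›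
    exact ⟨l₀, 1, one_pos, fun l _ x hx => by simp [SEnl] at hx⟩
  · rintro s t hst ⟨l₀, δ, hδ, H⟩
    exact ⟨l₀, δ, hδ, fun l hl x hx => H l hl x (Set.biUnion_subset_biUnion_left hst hx)⟩
  · rintro s t ⟨l₁, δ₁, hδ₁, H₁⟩ ⟨l₂, δ₂, hδ₂, H₂⟩
    obtain ⟨l₀, h₁, h₂⟩ := hdir l₁ l₂
    refine ⟨l₀, min δ₁ δ₂, lt_min hδ₁ hδ₂, fun l hl x hx => ?_⟩
    obtain ⟨a, ha, hxa⟩ := Set.mem_iUnion₂.1 hx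
    rcases ha with ha | ha
    · exact H₁ l (h₁.trans hl) x
        (Set.mem_biUnion ha (Metric.ball_subset_ball (min_le_left _ _) hxa))
    · exact H₂ l (h₂.trans hl) x
        (Set.mem_biUnion ha (Metric.ball_subset_ball (min_le_right _ _) hxa))
  · intro x _
    obtain ⟨l₀, δ, hδ, H⟩ := h x ε hε
    refine ⟨Metric.ball x (δ / 2),
      mem_nhdsWithin_of_mem_nhds (Metric.ball_mem_nhds x (half_pos hδ)),
      l₀, δ / 2, half_pos hδ, fun l hl z hz => H l hl z ?_⟩
    obtain ⟨a, ha, hza⟩ := Set.mem_iUnion₂.1 hz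
    refine Set.mem_biUnion (Set.mem_singleton x) ?_
    rw [Metric.mem_ball] at *
    linarith [dist_triangle z a x]
end

section
/- Let ⟨X,d⟩ and ⟨Y,ρ⟩ be metric spaces, let ⟨f_λ⟩_{λ∈Λ} be a net of functions from X to Y and ⟨A_λ⟩_{λ∈Λ} a net of nonempty subsets of X over a directed set Λ. Suppose A is a nonempty subset of X and f : X → Y satisfy: (i) for every n ∈ ℕ, A_λ ⊆ S_d(A,1/n) eventually; and (ii) ⟨f_λ⟩ is very strongly uniformly convergent to f on A. Then Ω(f,A) ≥ limsup_{λ∈Λ} Ω(f_λ,A_λ) in [0,∞]. -/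
open Metric Filter ENNReal Topology

theorem mem_SEnl {X : Type*} [MetricSpace X] {A : Set X} {ε : ℝ} {x : X} :
    x ∈ SEnl A ε ↔ ∃ a ∈ A, dist x a < ε := by
  simp [SEnl]

theorem SEnl_mono {X : Type*} [MetricSpace X] {A : Set X} {ε δ : ℝ} (h : ε ≤ δ) :
    SEnl A ε ⊆ SEnl A δ := by
  intro x hx
  obtain ⟨a, ha, hxa⟩ := mem_SEnl.1 hx
  exact mem_SEnl.2 ⟨a, ha, hxa.trans_le h⟩

theorem SEnl_subset_of_subset_SEnl {X : Type*} [MetricSpace X] {A B : Set X} {ε δ : ℝ}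
    (h : B ⊆ SEnl A ε) : SEnl B δ ⊆ SEnl A (δ + ε) := by
  intro x hx
  obtain ⟨b, hb, hxb⟩ := mem_SEnl.1 hx
  obtain ⟨a, ha, hba⟩ := mem_SEnl.1 (h hb)
  exact mem_SEnl.2 ⟨a, ha, (dist_triangle x b a).trans_lt (add_lt_add hxb hba)⟩

theorem edist_le_OmegaN {X Y : Type*} [MetricSpace X] [MetricSpace Y] {f : X → Y} {A : Set X}
    {n : ℕ} {x w : X} (hx : x ∈ SEnl A (1 / (n : ℝ))) (hw : w ∈ SEnl A (1 / (n : ℝ)))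
    (hxw : dist x w < 1 / (n : ℝ)) : edist (f x) (f w) ≤ OmegaN f A n :=
  le_iSup₂_of_le x hx (le_iSup₂_of_le w hw (le_iSup_of_le hxw le_rfl))

/-- If `A_λ ⊆ S_d(A,1/n)` eventually for every `n`, and `⟨f_λ⟩` is very strongly uniformly
convergent to `f` on `A`, then `Ω(f,A) ≥ limsup_λ Ω(f_λ,A_λ)`. -/
theorem oscillation_limsup_le
    {X Y Λ : Type*} [MetricSpace X] [MetricSpace Y] [Nonempty Λ] [Preorder Λ]
    (hdir : ∀ a b : Λ, ∃ c : Λ, a ≤ c ∧ b ≤ c)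
    (F : Λ → X → Y) (A : Λ → Set X) (hAne : ∀ l, (A l).Nonempty)
    (f : X → Y) (A₀ : Set X) (hA₀ : A₀.Nonempty)
    (h₁ : ∀ n : ℕ, 0 < n → ∀ᶠ l in atTop, A l ⊆ SEnl A₀ (1 / (n : ℝ)))
    (h₂ : VeryStronglyUniformlyConvergentOn F f A₀) :
    limsup (fun l => Omega (F l) (A l)) atTop ≤ Omega f A₀ := by
  refine le_iInf fun n => ENNReal.le_of_forall_pos_le_add fun ε hε _ => ?_
  obtain ⟨l₀, δ, hδ, hconv⟩ := h₂ (ε / 2) (by positivity)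
  have hn : (0 : ℝ) < 1 / ((n + 1 : ℕ) : ℝ) := by positivity
  obtain ⟨m, hm⟩ := exists_nat_one_div_lt (half_pos (lt_min hδ hn))
  rw [← Nat.cast_succ] at hm
  have hmδ := min_le_left δ (1 / ((n + 1 : ℕ) : ℝ))
  have hmn := min_le_right δ (1 / ((n + 1 : ℕ) : ℝ))
  refine limsup_le_of_le (by isBoundedDefault) ?_
  filter_upwards [h₁ (m + 1) m.succ_pos, eventually_ge_atTop l₀] with l hl hl₀
  have hsub := SEnl_subset_of_subset_SEnl (δ := 1 / ((m + 1 : ℕ) : ℝ)) hl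
  have hclose : ∀ x ∈ SEnl (A l) (1 / ((m + 1 : ℕ) : ℝ)),
      edist (F l x) (f x) ≤ ENNReal.ofReal (ε / 2) := fun x hx => by
    rw [edist_dist]
    exact ENNReal.ofReal_le_ofReal
      (hconv l hl₀ x (SEnl_mono (by linarith) (hsub hx))).le
  refine (iInf_le _ m).trans (iSup₂_le fun x hx => iSup₂_le fun w hw => iSup_le fun hxw => ?_)
  have hsub' := hsub.trans (SEnl_mono (δ := 1 / ((n + 1 : ℕ) : ℝ)) (by linarith))
  have hf : edist (f x) (f w) ≤ OmegaN f A₀ (n + 1) :=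
    edist_le_OmegaN (hsub' hx) (hsub' hw) (by linarith)
  calc edist (F l x) (F l w)
      ≤ edist (F l x) (f x) + edist (f x) (f w) + edist (f w) (F l w) := edist_triangle4 _ _ _ _
    _ ≤ ENNReal.ofReal (ε / 2) + OmegaN f A₀ (n + 1) + ENNReal.ofReal (ε / 2) := by
        gcongr
        · exact hclose x hx
        · rw [edist_comm]
          exact hclose w hw
    _ = OmegaN f A₀ (n + 1) + (ENNReal.ofReal (ε / 2) + ENNReal.ofReal (ε / 2)) := by ring
    _ = OmegaN f A₀ (n + 1) + ε := by
        rw [← ENNReal.ofReal_add (by positivity) (by positivity), add_halves,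
          ENNReal.ofReal_coe_nnreal]
end

section
/- Let ⟨X,d⟩ be a metric space, let A be a nonempty subset of X, and suppose C and E are nonempty closed subsets of X with C ⊆ A, C ∩ E = ∅, and gap zero between them, i.e., inf{d(c,e) : c ∈ C, e ∈ E} = 0. Then there exists a continuous function f : X → ℝ with Ω(f,A) = ∞. -/
open Metric Filter ENNReal Topology

/-- The gap `inf {d(c,e) : c ∈ C, e ∈ E}` between two sets. -/
noncomputable def gap {X : Type*} [MetricSpace X] (C E : Set X) : ℝ :=
  sInf {r : ℝ | ∃ c ∈ C, ∃ e ∈ E, r = dist c e}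

theorem exists_dist_lt_of_gap_zero {X : Type*} [MetricSpace X] {C E : Set X}
    (hC : C.Nonempty) (hE : E.Nonempty) (hgap : gap C E = 0) {ε : ℝ} (hε : 0 < ε) :
    ∃ c ∈ C, ∃ e ∈ E, dist c e < ε := by
  obtain ⟨c, hc⟩ := hC
  obtain ⟨e, he⟩ := hE
  have hne : {r : ℝ | ∃ c ∈ C, ∃ e ∈ E, r = dist c e}.Nonempty := ⟨_, c, hc, e, he, rfl⟩
  obtain ⟨r, ⟨c, hc, e, he, rfl⟩, hr⟩ := exists_lt_of_csInf_lt hne (hgap.trans_lt hε)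
  exact ⟨c, hc, e, he, hr⟩

theorem Omega_eq_top_of_forall_exists {X Y : Type*} [MetricSpace X] [MetricSpace Y]
    {f : X → Y} {A : Set X}
    (h : ∀ ε > 0, ∀ K : ℝ, ∃ x ∈ A, ∃ w, dist x w < ε ∧ K ≤ dist (f x) (f w)) :
    Omega f A = ⊤ := by
  refine iInf_eq_top.2 fun n => ENNReal.eq_top_of_forall_nnreal_le fun K => ?_
  have hn : (0 : ℝ) < 1 / ((n + 1 : ℕ) : ℝ) := by positivity
  obtain ⟨x, hx, w, hxw, hK⟩ := h _ hn K
  have hxA : x ∈ SEnl A (1 / ((n + 1 : ℕ) : ℝ)) :=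
    Set.mem_biUnion hx (Metric.mem_ball_self hn)
  have hwA : w ∈ SEnl A (1 / ((n + 1 : ℕ) : ℝ)) :=
    Set.mem_biUnion hx (Metric.mem_ball'.2 hxw)
  calc (K : ℝ≥0∞) ≤ edist (f x) (f w) := by
        rw [edist_dist, ← ENNReal.ofReal_coe_nnreal]
        exact ENNReal.ofReal_le_ofReal hK
    _ ≤ OmegaN f A (n + 1) :=
        le_iSup₂_of_le x hxA <| le_iSup₂_of_le w hwA <|
          le_iSup_of_le hxw le_rfl

/-- If `C` and `E` are disjoint nonempty closed sets with `C ⊆ A` and gap zero between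
them, then some continuous `f : X → ℝ` has `Ω(f,A) = ∞`. -/
theorem exists_continuous_oscillation_top_of_gap_zero
    {X : Type*} [MetricSpace X] (A C E : Set X) (hA : A.Nonempty)
    (hC : C.Nonempty) (hE : E.Nonempty) (hCcl : IsClosed C) (hEcl : IsClosed E)
    (hCA : C ⊆ A) (hdisj : C ∩ E = ∅) (hgap : gap C E = 0) :
    ∃ f : X → ℝ, Continuous f ∧ Omega f A = ⊤ := by
  have hpos : ∀ x, 0 < infDist x C + infDist x E := fun x => by
    by_cases hx : x ∈ C
    · have hxE : x ∉ E := fun h => (hdisj ▸ ⟨hx, h⟩ : x ∈ (∅ : Set X))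
      exact add_pos_of_nonneg_of_pos infDist_nonneg ((hEcl.notMem_iff_infDist_pos hE).1 hxE)
    · exact add_pos_of_pos_of_nonneg ((hCcl.notMem_iff_infDist_pos hC).1 hx) infDist_nonneg
  refine ⟨fun x => infDist x E / (infDist x C + infDist x E) ^ 2, ?_, ?_⟩
  · exact (continuous_infDist_pt E).div
      (((continuous_infDist_pt C).add (continuous_infDist_pt E)).pow 2)
      fun x => (pow_pos (hpos x) 2).ne'
  · refine Omega_eq_top_of_forall_exists fun ε hε K => ?_
    obtain ⟨c, hc, e, he, hce⟩ := exists_dist_lt_of_gap_zero hC hE hgap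
      (lt_min hε (by positivity : 0 < (|K| + 1)⁻¹))
    obtain ⟨hce₁, hce₂⟩ := lt_min_iff.1 hce
    refine ⟨c, hCA hc, e, hce₁, ?_⟩
    have hcE : 0 < infDist c E := by simpa [infDist_zero_of_mem hc] using hpos c
    have hle : infDist c E ≤ (|K| + 1)⁻¹ := (infDist_le_dist_of_mem he).trans hce₂.le
    have hval : infDist c E / infDist c E ^ 2 = (infDist c E)⁻¹ := by
      field_simp
    rw [infDist_zero_of_mem hc, infDist_zero_of_mem he, zero_add, zero_div, hval, dist_zero_right,
      Real.norm_of_nonneg (inv_nonneg.2 hcE.le)]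
    have hinv : |K| + 1 ≤ (infDist c E)⁻¹ := (le_inv_comm₀ hcE (by positivity)).1 hle
    linarith [le_abs_self K]
end

section
/- Let ⟨X,d⟩ and ⟨Y,ρ⟩ be metric spaces, let f : X → Y be continuous on X, and let A be a nonempty compact subset of X. Then Ω(f,A) = 0, i.e., f is strongly uniformly continuous on A. -/
open Metric Filter ENNReal Topology

/-- A continuous function is strongly uniformly continuous on every nonempty compact
subset: `Ω(f,A) = 0`. -/
theorem oscillation_eq_zero_of_compact
    {X Y : Type*} [MetricSpace X] [MetricSpace Y]
    (f : X → Y) (hf : Continuous f) (A : Set X) (hA : A.Nonempty)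
    (hK : IsCompact A) :
    Omega f A = 0 := by
  refine le_antisymm (ENNReal.le_of_forall_pos_le_add fun ε hε _ => ?_) bot_le
  have hε2 : (0 : ℝ≥0∞) < (ε : ℝ≥0∞) / 2 :=
    ENNReal.div_pos (by exact_mod_cast hε.ne') (by simp)
  obtain ⟨δ, hδ, h⟩ := Metric.mem_uniformity_dist.1
    (hK.uniformContinuousAt_of_continuousAt f (fun a _ => hf.continuousAt)
      (edist_mem_uniformity hε2))
  have near {a x : X} (ha : a ∈ A) (hx : dist a x < δ) :
      edist (f a) (f x) ≤ (ε : ℝ≥0∞) / 2 := (h hx ha).le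
  obtain ⟨n, hn⟩ := exists_nat_one_div_lt (half_pos hδ)
  rw [zero_add]
  refine (iInf_le _ n).trans (iSup₂_le fun x hx => iSup₂_le fun w _ => iSup_le fun hxw => ?_)
  simp only [SEnl, Set.mem_iUnion, Metric.mem_ball, exists_prop] at hx
  obtain ⟨a, ha, hxa⟩ := hx
  push_cast at hxa hxw
  rw [dist_comm] at hxa
  have haw := dist_triangle a x w
  calc edist (f x) (f w) ≤ edist (f a) (f x) + edist (f a) (f w) := edist_triangle_left _ _ _
    _ ≤ (ε : ℝ≥0∞) / 2 + (ε : ℝ≥0∞) / 2 :=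
      add_le_add (near ha (by linarith)) (near ha (by linarith))
    _ = ε := ENNReal.add_halves _
end

section
/- Let ⟨X,d⟩ be a metric space and let f : X → ℝ be continuous. Define d̂(x,w) := d(x,w) + |f(x) − f(w)| for x, w ∈ X. Then d̂ is a metric on X generating the same topology as d, f is Lipschitz (with constant 1) with respect to d̂, and for every nonempty subset A of X the oscillation of f at A computed with respect to d̂ satisfies Ω_{d̂}(f,A) = 0. -/
open Metric Filter ENNReal Topology

/-- The open ball of radius `r` about `x` with respect to a distance function `e`. -/
def ball' {X : Type*} (e : X → X → ℝ) (x : X) (r : ℝ) : Set X := {y | e x y < r}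

/-- The `ε`-enlargement of `A` with respect to a distance function `e`. -/
def SEnl' {X : Type*} (e : X → X → ℝ) (A : Set X) (ε : ℝ) : Set X :=
  ⋃ a ∈ A, ball' e a ε

/-- `Ω_n^e(f,A) = sup {|f x − f w| : x, w ∈ S_e(A,1/n), e(x,w) < 1/n}` in `[0,∞]`. -/
noncomputable def OmegaN' {X : Type*} (e : X → X → ℝ) (f : X → ℝ) (A : Set X) (n : ℕ) :
    ℝ≥0∞ :=
  ⨆ (x ∈ SEnl' e A (1 / (n : ℝ))) (w ∈ SEnl' e A (1 / (n : ℝ))) (_ : e x w < 1 / (n : ℝ)),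
    ENNReal.ofReal |f x - f w|

/-- The oscillation of `f` at `A` with respect to the distance function `e`. -/
noncomputable def Omega' {X : Type*} (e : X → X → ℝ) (f : X → ℝ) (A : Set X) : ℝ≥0∞ :=
  ⨅ n : ℕ, OmegaN' e f A (n + 1)

/-- A function that is `1`-Lipschitz for a distance function has zero oscillation at every set. -/
theorem omega_eq_zero_of_abs_sub_le {X : Type*} {e : X → X → ℝ} {f : X → ℝ}
    (h : ∀ x w, |f x - f w| ≤ e x w) (A : Set X) : Omega' e f A = 0 := by
  have hle : ∀ n : ℕ, Omega' e f A ≤ ENNReal.ofReal (1 / ((n : ℝ) + 1)) := fun n => by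
    refine (iInf_le _ n).trans ?_
    refine iSup₂_le fun x _ => iSup₂_le fun w _ => iSup_le fun hxw => ?_
    refine ENNReal.ofReal_le_ofReal ((h x w).trans ?_)
    exact_mod_cast hxw.le
  have hlim : Tendsto (fun n : ℕ => ENNReal.ofReal (1 / ((n : ℝ) + 1))) atTop (𝓝 0) := by
    simpa using ENNReal.tendsto_ofReal (tendsto_one_div_add_atTop_nhds_zero_nat (𝕜 := ℝ))
  exact le_antisymm (ge_of_tendsto' hlim hle) zero_le

/-- For continuous `f : X → ℝ`, the distance `d̂(x,w) = d(x,w) + |f(x) − f(w)|` is a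
metric on `X` generating the same topology as `d`, `f` is `1`-Lipschitz with respect to
`d̂`, and the oscillation of `f` at every nonempty `A ⊆ X` computed with `d̂` is zero. -/
theorem oscillation_zero_for_sum_metric
    {X : Type*} [MetricSpace X] (f : X → ℝ) (hf : Continuous f)
    (dh : X → X → ℝ) (hdh : ∀ x w, dh x w = dist x w + |f x - f w|) :
    (∀ x w, dh x w = 0 ↔ x = w) ∧
    (∀ x w, dh x w = dh w x) ∧
    (∀ x w z, dh x z ≤ dh x w + dh w z) ∧
    (∀ x : X, ∀ ε : ℝ, 0 < ε → ∃ δ : ℝ, 0 < δ ∧ ball' dh x δ ⊆ Metric.ball x ε) ∧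
    (∀ x : X, ∀ ε : ℝ, 0 < ε → ∃ δ : ℝ, 0 < δ ∧ Metric.ball x δ ⊆ ball' dh x ε) ∧
    (∀ x w, |f x - f w| ≤ 1 * dh x w) ∧
    (∀ A : Set X, A.Nonempty → Omega' dh f A = 0) := by
  simp only [one_mul]
  have lip : ∀ x w, |f x - f w| ≤ dh x w := fun x w => by
    rw [hdh]
    exact le_add_of_nonneg_left dist_nonneg
  have dist_le : ∀ x w, dist x w ≤ dh x w := fun x w => by
    rw [hdh]
    exact le_add_of_nonneg_right (abs_nonneg _)
  refine ⟨fun x w => ⟨fun h => ?_, ?_⟩, fun x w => ?_, fun x w z => ?_, fun x ε hε => ?_,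
    fun x ε hε => ?_, lip, fun A _ => omega_eq_zero_of_abs_sub_le lip A⟩
  · exact dist_le_zero.mp (h ▸ dist_le x w)
  · rintro rfl
    simp [hdh]
  · rw [hdh, hdh, dist_comm, abs_sub_comm]
  · rw [hdh, hdh, hdh]
    linarith [dist_triangle x w z, abs_sub_le (f x) (f w) (f z)]
  · refine ⟨ε, hε, fun y hy => ?_⟩
    rw [mem_ball, dist_comm]
    exact (dist_le x y).trans_lt hy
  · obtain ⟨δ, hδ, h⟩ := Metric.continuous_iff.mp hf x (ε / 2) (half_pos hε)
    refine ⟨min δ (ε / 2), lt_min hδ (half_pos hε), fun y hy => ?_⟩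
    rw [mem_ball, lt_min_iff] at hy
    have hfy := h y hy.1
    rw [Real.dist_eq] at hfy
    change dh x y < ε
    rw [hdh, dist_comm, abs_sub_comm]
    linarith [hy.2]
end
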